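/- Let n ≥ 3 and let X be a C³ vector field on the open unit ball B ⊂ EuclideanSpace ℝ n that is a Euclidean conformal Killing field on B (hence a conformal Killing field of the hyperbolic metric b in the ball model). Set u = −div_b X = −(div X + n·⟪∇φ, X⟫). Then for every x ∈ B and all v, w, the hyperbolic Hessian of u satisfies Hess_b u x (v, w) = u(x)·e^{2φ(x)}·⟪v, w⟫, i.e. Hess^b(δ^b X) = (δ^b X)·b. (This is Lemma 2.2 of the paper applied to the hyperbolic metric, which is Einstein with Ric^b = −(n−1)·b, i.e. λ = −1: the divergence of a conformal Killing field lies in the kernel of (DScal)_b*, satisfying Hess^b(δ^b X) = −λ·(δ^b X)·b.) -/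

import Mathlib

open scoped RealInnerProductSpace

/-- The `i`-th standard basis vector of `EuclideanSpace ℝ (Fin n)`. -/
noncomputable def stdBasis (n : ℕ) (i : Fin n) : EuclideanSpace ℝ (Fin n) :=
  EuclideanSpace.single i (1 : ℝ)

/-- The Euclidean divergence of a vector field: the trace of its derivative. -/
noncomputable def divE (n : ℕ) (X : EuclideanSpace ℝ (Fin n) → EuclideanSpace ℝ (Fin n))
    (x : EuclideanSpace ℝ (Fin n)) : ℝ :=
  ∑ i : Fin n, ⟪fderiv ℝ X x (stdBasis n i), stdBasis n i⟫

/-- The conformal factor `φ(x) = log(2/(1 − ‖x‖²))` of the ball model of hyperbolic space. -/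
noncomputable def phiHyp (n : ℕ) (x : EuclideanSpace ℝ (Fin n)) : ℝ :=
  Real.log (2 / (1 - ‖x‖ ^ 2))

/-- The Euclidean gradient of the conformal factor: `∇φ(x) = 2x/(1 − ‖x‖²)`. -/
noncomputable def gradPhi (n : ℕ) (x : EuclideanSpace ℝ (Fin n)) :
    EuclideanSpace ℝ (Fin n) :=
  (2 / (1 - ‖x‖ ^ 2)) • x

/-- The hyperbolic Hessian of a function `u` on the ball model:
`Hess_b u (v,w) = Hess u (v,w) − dφ(v)·du(w) − du(v)·dφ(w) + ⟪∇φ, ∇u⟫·⟪v,w⟫`. -/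
noncomputable def hessHyp (n : ℕ) (u : EuclideanSpace ℝ (Fin n) → ℝ)
    (x v w : EuclideanSpace ℝ (Fin n)) : ℝ :=
  fderiv ℝ (fderiv ℝ u) x v w
    - fderiv ℝ (phiHyp n) x v * fderiv ℝ u x w
    - fderiv ℝ u x v * fderiv ℝ (phiHyp n) x w
    + ⟪gradPhi n x, gradient u x⟫ * ⟪v, w⟫

open Metric in
lemma aux_rho (n : ℕ) (x : EuclideanSpace ℝ (Fin n)) (hx : x ∈ ball (0 : EuclideanSpace ℝ (Fin n)) 1) :
    HasFDerivAt (fun y : EuclideanSpace ℝ (Fin n) => 2 / (1 - ‖y‖ ^ 2))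
      ((2 / (1 - ‖x‖ ^ 2)) ^ 2 • innerSL ℝ x) x := by
  have h1 : ‖x‖ < 1 := by simpa using hx
  have h2 : 1 - ‖x‖ ^ 2 ≠ 0 := by nlinarith [norm_nonneg x]
  have h3 : HasFDerivAt (fun y : EuclideanSpace ℝ (Fin n) => 1 - ‖y‖ ^ 2)
      (-(2 • innerSL ℝ x)) x := by
    have := (hasStrictFDerivAt_norm_sq x).hasFDerivAt
    simpa using this.const_sub 1
  have h4 : HasDerivAt (fun t : ℝ => 2 / t) (-2 / (1 - ‖x‖ ^ 2) ^ 2) (1 - ‖x‖ ^ 2) := by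
    have := (hasDerivAt_inv h2).const_mul 2
    refine HasDerivAt.congr_deriv this ?_
    ring
  have h5 := h4.comp_hasFDerivAt x h3
  refine HasFDerivAt.congr_fderiv h5 ?_
  ext v
  simp
  field_simp

open Metric in
lemma aux_phi (n : ℕ) (x : EuclideanSpace ℝ (Fin n)) (hx : x ∈ ball (0 : EuclideanSpace ℝ (Fin n)) 1)
    (v : EuclideanSpace ℝ (Fin n)) :
    fderiv ℝ (phiHyp n) x v = (2 / (1 - ‖x‖ ^ 2)) * ⟪x, v⟫ := by
  have h1 : ‖x‖ < 1 := by simpa using hx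
  have h2 : 1 - ‖x‖ ^ 2 ≠ 0 := by nlinarith [norm_nonneg x]
  have h3 : 2 / (1 - ‖x‖ ^ 2) ≠ 0 := by positivity
  have h := (aux_rho n x hx).log h3
  have h' : HasFDerivAt (phiHyp n) _ x := h
  rw [h'.fderiv]
  simp
  field_simp

lemma aux_trace (n : ℕ) (hn : 3 ≤ n)
    (Q : EuclideanSpace ℝ (Fin n) →L[ℝ] EuclideanSpace ℝ (Fin n) →L[ℝ] ℝ)
    (h : ∀ z v a b, Q z a * ⟪v, b⟫ - Q z b * ⟪v, a⟫ = Q v a * ⟪z, b⟫ - Q v b * ⟪z, a⟫)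
    (z b : EuclideanSpace ℝ (Fin n)) : Q z b = 0 := by
  have hb : ∀ z : EuclideanSpace ℝ (Fin n), ∑ i, ⟪z, stdBasis n i⟫ • stdBasis n i = z := by
    intro z
    have := (EuclideanSpace.basisFun (Fin n) ℝ).sum_repr' z
    simpa [stdBasis, real_inner_comm] using this
  have hone : ∀ i, ⟪stdBasis n i, stdBasis n i⟫ = (1 : ℝ) := by
    intro i; simp [stdBasis]
  have hn' : (3 : ℝ) ≤ n := by exact_mod_cast hn
  set T := ∑ i, Q (stdBasis n i) (stdBasis n i) with hT
  have h1 : ∀ z b, (2 - (n : ℝ)) * Q z b = T * ⟪z, b⟫ := by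
    intro z b
    have e : ∑ i, (Q z (stdBasis n i) * ⟪stdBasis n i, b⟫ - Q z b * ⟪stdBasis n i, stdBasis n i⟫) =
        ∑ i, (Q (stdBasis n i) (stdBasis n i) * ⟪z, b⟫ - Q (stdBasis n i) b * ⟪z, stdBasis n i⟫) :=
      Finset.sum_congr rfl fun i _ => h z _ _ b
    rw [Finset.sum_sub_distrib, Finset.sum_sub_distrib, ← Finset.sum_mul, ← hT] at e
    have e1 : ∑ i, Q z (stdBasis n i) * ⟪stdBasis n i, b⟫ = Q z b := by
      conv_rhs => rw [← hb b]
      rw [map_sum]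
      refine Finset.sum_congr rfl fun i _ => ?_
      rw [map_smul, smul_eq_mul, real_inner_comm, mul_comm]
    have e2 : ∑ i, Q (stdBasis n i) b * ⟪z, stdBasis n i⟫ = Q z b := by
      conv_rhs => rw [← hb z]
      rw [map_sum, sum_apply]
      refine Finset.sum_congr rfl fun i _ => ?_
      rw [map_smul, smul_apply, smul_eq_mul, mul_comm]
    have e3 : ∑ i, Q z b * ⟪stdBasis n i, stdBasis n i⟫ = n * Q z b := by
      simp only [hone]; simp
    rw [e1, e2, e3] at e
    linarith
  have h2 : (2 - (n : ℝ)) * T = T * n := by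
    conv_lhs => rw [hT, Finset.mul_sum]
    rw [Finset.sum_congr rfl fun i _ => h1 _ _]
    simp only [hone]; simp [mul_comm]
  have h3 : T = 0 := by
    have : (2 - 2 * (n : ℝ)) * T = 0 := by linarith
    rcases mul_eq_zero.1 this with h | h
    · linarith
    · exact h
  have h4 := h1 z b
  rw [h3, zero_mul] at h4
  rcases mul_eq_zero.1 h4 with h | h
  · linarith
  · exact h

/-- **Lemma 2.2 for the hyperbolic metric (λ = −1).** If `n ≥ 3` and `X` is a `C³`
Euclidean conformal Killing field on the unit ball (hence a conformal Killing field of the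
hyperbolic metric `b = e^{2φ}·⟪·,·⟫`), then `u = δ^b X = −(div X + n·⟪∇φ, X⟫)` satisfies
`Hess^b u = u·b`, i.e. `Hess_b u x (v, w) = u(x)·e^{2φ(x)}·⟪v, w⟫` on the ball. -/
theorem hyperbolic_hessian_div_conformal_killing
    (n : ℕ) (hn : 3 ≤ n)
    (X : EuclideanSpace ℝ (Fin n) → EuclideanSpace ℝ (Fin n))
    (hX : ContDiffOn ℝ 3 X (Metric.ball (0 : EuclideanSpace ℝ (Fin n)) 1))
    (hCK : ∀ x ∈ Metric.ball (0 : EuclideanSpace ℝ (Fin n)) 1,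
      ∀ v w : EuclideanSpace ℝ (Fin n),
        ⟪fderiv ℝ X x v, w⟫ + ⟪fderiv ℝ X x w, v⟫ =
          (2 / (n : ℝ)) * divE n X x * ⟪v, w⟫) :
    ∀ x ∈ Metric.ball (0 : EuclideanSpace ℝ (Fin n)) 1,
      ∀ v w : EuclideanSpace ℝ (Fin n),
        hessHyp n (fun y => -(divE n X y + (n : ℝ) * ⟪gradPhi n y, X y⟫)) x v w =
          (-(divE n X x + (n : ℝ) * ⟪gradPhi n x, X x⟫)) *
            Real.exp (2 * phiHyp n x) * ⟪v, w⟫ := by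
  have hn0 : (n : ℝ) ≠ 0 := by positivity
  have hnb : ∀ y ∈ Metric.ball (0 : EuclideanSpace ℝ (Fin n)) 1,
      Metric.ball (0 : EuclideanSpace ℝ (Fin n)) 1 ∈ nhds y := fun y hy =>
    Metric.isOpen_ball.mem_nhds hy
  have hopen : IsOpen (Metric.ball (0 : EuclideanSpace ℝ (Fin n)) 1) := Metric.isOpen_ball
  set B := Metric.ball (0 : EuclideanSpace ℝ (Fin n)) 1 with hB
  have hX1 : ContDiffOn ℝ 2 (fderiv ℝ X) B := hX.fderiv_of_isOpen hopen (by norm_num)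
  have hX2 : ContDiffOn ℝ 1 (fderiv ℝ (fderiv ℝ X)) B :=
    hX1.fderiv_of_isOpen hopen (by norm_num)
  have hS : ContDiffOn ℝ 2 (divE n X) B := by
    unfold divE
    refine ContDiffOn.sum fun i _ => ?_
    exact (hX1.clm_apply contDiffOn_const).inner ℝ contDiffOn_const
  have hS1 : ContDiffOn ℝ 1 (fderiv ℝ (divE n X)) B :=
    hS.fderiv_of_isOpen hopen (by norm_num)
  have dX : ∀ y ∈ B, HasFDerivAt X (fderiv ℝ X y) y := fun y hy =>
    ((hX.contDiffAt (hnb y hy)).differentiableAt (by norm_num)).hasFDerivAt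
  have dX1 : ∀ y ∈ B, HasFDerivAt (fderiv ℝ X) (fderiv ℝ (fderiv ℝ X) y) y := fun y hy =>
    ((hX1.contDiffAt (hnb y hy)).differentiableAt (by norm_num)).hasFDerivAt
  have dX2 : ∀ y ∈ B, HasFDerivAt (fderiv ℝ (fderiv ℝ X))
      (fderiv ℝ (fderiv ℝ (fderiv ℝ X)) y) y := fun y hy =>
    ((hX2.contDiffAt (hnb y hy)).differentiableAt (by norm_num)).hasFDerivAt
  have dS : ∀ y ∈ B, HasFDerivAt (divE n X) (fderiv ℝ (divE n X) y) y := fun y hy =>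
    ((hS.contDiffAt (hnb y hy)).differentiableAt (by norm_num)).hasFDerivAt
  have dS1 : ∀ y ∈ B, HasFDerivAt (fderiv ℝ (divE n X))
      (fderiv ℝ (fderiv ℝ (divE n X)) y) y := fun y hy =>
    ((hS1.contDiffAt (hnb y hy)).differentiableAt (by norm_num)).hasFDerivAt
  have sX : ∀ y ∈ B, ∀ v w, fderiv ℝ (fderiv ℝ X) y v w = fderiv ℝ (fderiv ℝ X) y w v :=
    fun y hy v w => ((hX.contDiffAt (hnb y hy)).isSymmSndFDerivAt (by simp; norm_num)) v w
  have sX1 : ∀ y ∈ B, ∀ v w, fderiv ℝ (fderiv ℝ (fderiv ℝ X)) y v w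
      = fderiv ℝ (fderiv ℝ (fderiv ℝ X)) y w v :=
    fun y hy v w => ((hX1.contDiffAt (hnb y hy)).isSymmSndFDerivAt (by simp)) v w
  set S := divE n X with hSdef
  -- first differentiation
  have K2 : ∀ y ∈ B, ∀ z v w, ⟪fderiv ℝ (fderiv ℝ X) y z v, w⟫ +
      ⟪fderiv ℝ (fderiv ℝ X) y z w, v⟫ = (2 / (n : ℝ)) * fderiv ℝ S y z * ⟪v, w⟫ := by
    intro y hy z v w
    have h1 : HasFDerivAt (fun p => ⟪fderiv ℝ X p v, w⟫ + ⟪fderiv ℝ X p w, v⟫) _ y :=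
      ((((dX1 y hy).clm_apply (hasFDerivAt_const v y))).inner ℝ (hasFDerivAt_const w y)).add
      ((((dX1 y hy).clm_apply (hasFDerivAt_const w y))).inner ℝ (hasFDerivAt_const v y))
    have h2 : HasFDerivAt (fun p => (2 / (n : ℝ)) * S p * ⟪v, w⟫) _ y :=
      ((dS y hy).const_mul (2 / (n : ℝ))).mul_const ⟪v, w⟫
    have h3 := h2.congr_of_eventuallyEq (Filter.mem_of_superset (hnb y hy) fun p hp => hCK p hp v w)
    have h4 := DFunLike.congr_fun (h1.unique h3) z
    simp at h4
    linarith
  have K3 : ∀ y ∈ B, ∀ z v w, (n : ℝ) * ⟪fderiv ℝ (fderiv ℝ X) y z v, w⟫ =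
      fderiv ℝ S y z * ⟪v, w⟫ + fderiv ℝ S y v * ⟪z, w⟫ - fderiv ℝ S y w * ⟪z, v⟫ := by
    intro y hy z v w
    have a1 := K2 y hy z v w
    have a2 := K2 y hy v z w
    have a3 := K2 y hy w z v
    rw [sX y hy v z] at a2
    rw [sX y hy w z, sX y hy w v] at a3
    have e : ⟪fderiv ℝ (fderiv ℝ X) y z v, w⟫ = (1 / (n : ℝ)) * (
      fderiv ℝ S y z * ⟪v, w⟫ + fderiv ℝ S y v * ⟪z, w⟫ - fderiv ℝ S y w * ⟪z, v⟫) := by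
      linear_combination (1 / 2) * a1 + (1 / 2) * a2 - (1 / 2) * a3
    rw [e]; field_simp
  have K4 : ∀ y ∈ B, ∀ p z v w, (n : ℝ) * ⟪fderiv ℝ (fderiv ℝ (fderiv ℝ X)) y p z v, w⟫ =
      fderiv ℝ (fderiv ℝ S) y p z * ⟪v, w⟫ + fderiv ℝ (fderiv ℝ S) y p v * ⟪z, w⟫
        - fderiv ℝ (fderiv ℝ S) y p w * ⟪z, v⟫ := by
    intro y hy p z v w
    have h1 : HasFDerivAt (fun p => (n : ℝ) * ⟪fderiv ℝ (fderiv ℝ X) p z v, w⟫) _ y :=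
      ((((dX2 y hy).clm_apply (hasFDerivAt_const z y)).clm_apply
        (hasFDerivAt_const v y)).inner ℝ (hasFDerivAt_const w y)).const_mul (n : ℝ)
    have hs : ∀ v, HasFDerivAt (fun p => fderiv ℝ S p v) _ y := fun v =>
      (dS1 y hy).clm_apply (hasFDerivAt_const v y)
    have h2 : HasFDerivAt (fun p => fderiv ℝ S p z * ⟪v, w⟫ + fderiv ℝ S p v * ⟪z, w⟫
        - fderiv ℝ S p w * ⟪z, v⟫) _ y :=
      (((hs z).mul_const ⟪v, w⟫).add ((hs v).mul_const ⟪z, w⟫)).sub ((hs w).mul_const ⟪z, v⟫)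
    have h3 := h2.congr_of_eventuallyEq
      (Filter.mem_of_superset (hnb y hy) fun p hp => K3 p hp z v w)
    have h4 := DFunLike.congr_fun (h1.unique h3) p
    simp at h4
    linarith
  have S2 : ∀ y ∈ B, ∀ v w, fderiv ℝ (fderiv ℝ S) y v w = 0 := by
    intro y hy
    have sS : ∀ v w, fderiv ℝ (fderiv ℝ S) y v w = fderiv ℝ (fderiv ℝ S) y w v :=
      fun v w => ((hS.contDiffAt (hnb y hy)).isSymmSndFDerivAt (by simp)) v w
    refine aux_trace n hn _ fun z v a b => ?_
    have a1 := K4 y hy z v a b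
    have a2 := K4 y hy v z a b
    rw [sX1 y hy z v] at a1
    have := sS z v
    rw [this] at a1
    linarith
  -- the function u
  set u : EuclideanSpace ℝ (Fin n) → ℝ :=
    fun y => -(S y + (n : ℝ) * ⟪gradPhi n y, X y⟫) with hu
  have du : ∀ y ∈ B, ∃ L : EuclideanSpace ℝ (Fin n) →L[ℝ] ℝ, HasFDerivAt u L y ∧ ∀ w, L w = -(fderiv ℝ S y w + (n : ℝ) *
      ((2 / (1 - ‖y‖ ^ 2)) ^ 2 * ⟪y, w⟫ * ⟪y, X y⟫ +
        (2 / (1 - ‖y‖ ^ 2)) * (⟪w, X y⟫ + ⟪y, fderiv ℝ X y w⟫))) := by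
    intro y hy
    have h1 : HasFDerivAt u _ y := ((dS y hy).add
      ((((aux_rho n y hy).smul (hasFDerivAt_id y)).inner ℝ (dX y hy)).const_mul (n : ℝ))).neg
    refine ⟨_, h1, fun w => ?_⟩
    simp [inner_add_left, inner_smul_left]
    left
    ring
  have du' : ∀ y ∈ B, ∀ w, fderiv ℝ u y w = -(fderiv ℝ S y w + (n : ℝ) *
      ((2 / (1 - ‖y‖ ^ 2)) ^ 2 * ⟪y, w⟫ * ⟪y, X y⟫ +
        (2 / (1 - ‖y‖ ^ 2)) * (⟪w, X y⟫ + ⟪y, fderiv ℝ X y w⟫))) := by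
    intro y hy w
    obtain ⟨L, hL, hw⟩ := du y hy
    rw [hL.fderiv, hw]
  have hrho : ContDiffOn ℝ 2 (fun y : EuclideanSpace ℝ (Fin n) => 2 / (1 - ‖y‖ ^ 2)) B := by
    refine contDiffOn_const.div (contDiffOn_const.sub (contDiff_norm_sq ℝ).contDiffOn) ?_
    intro y hy
    have h1 : ‖y‖ < 1 := by simpa [hB] using hy
    nlinarith [norm_nonneg y]
  have hucd : ContDiffOn ℝ 2 u B := by
    refine (hS.add (contDiffOn_const.mul
      ((hrho.smul contDiffOn_id).inner ℝ (hX.of_le (by norm_num))))).neg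
  have du1 : ∀ y ∈ B, HasFDerivAt (fderiv ℝ u) (fderiv ℝ (fderiv ℝ u) y) y := fun y hy =>
    (((hucd.fderiv_of_isOpen hopen (m := 1) (by norm_num)).contDiffAt
      (hnb y hy)).differentiableAt (by norm_num)).hasFDerivAt
  intro x hx v w
  have hess : fderiv ℝ (fderiv ℝ u) x v w = -(n : ℝ) * (
      2 * (2 / (1 - ‖x‖ ^ 2)) ^ 3 * ⟪x, v⟫ * ⟪x, w⟫ * ⟪x, X x⟫
      + (2 / (1 - ‖x‖ ^ 2)) ^ 2 * ⟪v, w⟫ * ⟪x, X x⟫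
      + (2 / (1 - ‖x‖ ^ 2)) ^ 2 * ⟪x, w⟫ * (⟪v, X x⟫ + ⟪x, fderiv ℝ X x v⟫)
      + (2 / (1 - ‖x‖ ^ 2)) ^ 2 * ⟪x, v⟫ * (⟪w, X x⟫ + ⟪x, fderiv ℝ X x w⟫)
      + (2 / (1 - ‖x‖ ^ 2)) * (⟪w, fderiv ℝ X x v⟫ + ⟪v, fderiv ℝ X x w⟫
        + ⟪x, fderiv ℝ (fderiv ℝ X) x v w⟫)) := by
    have h1 : HasFDerivAt (fun y => fderiv ℝ u y w) _ x :=
      (du1 x hx).clm_apply (hasFDerivAt_const w x)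
    have hi := hasFDerivAt_id (𝕜 := ℝ) x
    have hr := aux_rho n x hx
    have h2 : HasFDerivAt (fun y => -(fderiv ℝ S y w + (n : ℝ) *
      ((2 / (1 - ‖y‖ ^ 2)) ^ 2 * ⟪y, w⟫ * ⟪y, X y⟫ +
        (2 / (1 - ‖y‖ ^ 2)) * (⟪w, X y⟫ + ⟪y, fderiv ℝ X y w⟫)))) _ x :=
      (((dS1 x hx).clm_apply (hasFDerivAt_const w x)).add
        (((((hr.pow 2).mul (hi.inner ℝ (hasFDerivAt_const w x))).mul
          (hi.inner ℝ (dX x hx))).add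
        (hr.mul (((hasFDerivAt_const w x).inner ℝ (dX x hx)).add
          (hi.inner ℝ ((dX1 x hx).clm_apply (hasFDerivAt_const w x)))))).const_mul (n : ℝ))).neg
    have h3 := h2.congr_of_eventuallyEq
      (Filter.mem_of_superset (hnb x hx) fun p hp => du' p hp w)
    have h4 := DFunLike.congr_fun (h1.unique h3) v
    simp [S2 x hx] at h4
    rw [h4]
    ring
  have hgrad : ⟪gradPhi n x, gradient u x⟫ = (2 / (1 - ‖x‖ ^ 2)) * fderiv ℝ u x x := by
    rw [gradPhi, inner_smul_left, real_inner_comm, gradient,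
      InnerProductSpace.toDual_symm_apply]
    simp
  have h1 : ‖x‖ < 1 := by simpa [hB] using hx
  have h2 : 0 < 1 - ‖x‖ ^ 2 := by nlinarith [norm_nonneg x]
  have hexp : Real.exp (2 * phiHyp n x) = (2 / (1 - ‖x‖ ^ 2)) ^ 2 := by
    rw [mul_comm, Real.exp_mul, phiHyp, Real.exp_log (by positivity)]
    norm_cast
  have hux : -(S x + (n : ℝ) * ⟪gradPhi n x, X x⟫) =
      -(S x + (n : ℝ) * ((2 / (1 - ‖x‖ ^ 2)) * ⟪x, X x⟫)) := by
    rw [gradPhi, inner_smul_left]; simp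
  have k3 := K3 x hx v w x
  have ck := hCK x hx v w
  have ckx := hCK x hx x x
  rw [hexp, hux, hessHyp, hess, hgrad, aux_phi n x hx, aux_phi n x hx, du' x hx, du' x hx, du' x hx]
  rw [real_inner_comm] at k3
  rw [real_inner_comm w, real_inner_comm v] at ck
  rw [real_inner_comm x (fderiv ℝ X x x), real_inner_self_eq_norm_sq] at ckx
  rw [real_inner_self_eq_norm_sq]
  rw [real_inner_comm x w, real_inner_comm x v] at k3
  have hr : (2 / (1 - ‖x‖ ^ 2)) * ‖x‖ ^ 2 = (2 / (1 - ‖x‖ ^ 2)) - 2 := by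
    field_simp; ring
  have hnn : (n : ℝ) * (2 / n) = 2 := by field_simp
  generalize 2 / (1 - ‖x‖ ^ 2) = r at *
  generalize 2 / (n : ℝ) = q at *
  linear_combination (-r) * k3 - n * r * ck - (n * r ^ 2 / 2) * ⟪v, w⟫ * ckx
    - (r * S x * ⟪v, w⟫ + r ^ 2 / 2 * ⟪v, w⟫ * S x * ‖x‖ ^ 2) * hnn
    - (r * S x + n * r ^ 2 * ⟪x, X x⟫) * ⟪v, w⟫ * hr
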